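/- Let H be a complex Hilbert space and let S be a completely nonunitary isometry on H, i.e., a bounded linear operator with ‖Sx‖ = ‖x‖ for all x and with ⋂_{n=0}^∞ Sⁿ(H) = {0}. Fix λ ∈ ℂ with |λ| < 1. Then the set of vectors { K_N(λ,w) : N = 0, 1, 2, …, w ∈ ker S* } spans a dense linear subspace of H; that is, the topological closure of its linear span is all of H. -/

import Mathlib

/-- `c N n = (n+1)(n+2)⋯(n+N)`. -/
def intertwineCoeff (N n : ℕ) : ℕ := ∏ i ∈ Finset.range N, (n + i + 1)

open Filter Topology

theorem intertwineCoeff_eq_descFactorial (N n : ℕ) :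
    intertwineCoeff N n = (n + N).descFactorial N := by
  rw [Nat.add_descFactorial_eq_ascFactorial, Nat.ascFactorial_eq_prod_range, intertwineCoeff]
  exact Finset.prod_congr rfl fun i _ => by ring

theorem intertwineCoeff_succ (N n : ℕ) :
    intertwineCoeff (N + 1) n = (n + 1) * intertwineCoeff N (n + 1) := by
  rw [intertwineCoeff, intertwineCoeff, Finset.prod_range_succ', mul_comm]
  congr 1
  exact Finset.prod_congr rfl fun i _ => by ring

theorem summable_intertwineCoeff_mul_pow (N : ℕ) {r : ℝ} (hr₀ : 0 ≤ r) (hr : r < 1) :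
    Summable fun n : ℕ => (intertwineCoeff N n : ℝ) * r ^ n := by
  simp_rw [intertwineCoeff_eq_descFactorial]
  exact summable_descFactorial_mul_geometric_of_norm_lt_one N
    (by rwa [Real.norm_of_nonneg hr₀])

/-- The termwise `N`-th derivative of the power series `∑ a n * z ^ n`. -/
noncomputable def iteratedDerivSeries (a : ℕ → ℂ) (N : ℕ) (z : ℂ) : ℂ :=
  ∑' n : ℕ, (intertwineCoeff N n : ℂ) * (z ^ n * a (N + n))

theorem hasDerivAt_iteratedDerivSeries {a : ℕ → ℂ} {C : ℝ} (ha : ∀ n, ‖a n‖ ≤ C) (N : ℕ)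
    {z : ℂ} (hz : ‖z‖ < 1) :
    HasDerivAt (iteratedDerivSeries a N) (iteratedDerivSeries a (N + 1) z) z := by
  obtain ⟨r, hzr, hr⟩ := exists_between hz
  have hr₀ : 0 ≤ r := (norm_nonneg z).trans hzr.le
  have hu := (summable_intertwineCoeff_mul_pow N hr₀ hr).mul_right C
  have hF (n : ℕ) : DifferentiableOn ℂ
      (fun w : ℂ => (intertwineCoeff N n : ℂ) * (w ^ n * a (N + n))) (Metric.ball 0 r) := by
    fun_prop
  have hle (n : ℕ) (w : ℂ) (hw : w ∈ Metric.ball (0 : ℂ) r) :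
      ‖(intertwineCoeff N n : ℂ) * (w ^ n * a (N + n))‖
        ≤ (intertwineCoeff N n : ℝ) * r ^ n * C := by
    rw [mem_ball_zero_iff] at hw
    rw [norm_mul, norm_mul, norm_pow, Complex.norm_natCast, mul_assoc]
    gcongr
    exact ha _
  have hzU : z ∈ Metric.ball (0 : ℂ) r := by simpa using hzr
  have hsum := Complex.hasSum_deriv_of_summable_norm hu hF Metric.isOpen_ball hle hzU
  have hdiff := (Complex.differentiableOn_tsum_of_summable_norm hu hF Metric.isOpen_ball
    hle).differentiableAt (Metric.isOpen_ball.mem_nhds hzU)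
  have hterm (n : ℕ) :
      deriv (fun w : ℂ => (intertwineCoeff N n : ℂ) * (w ^ n * a (N + n))) z
        = (intertwineCoeff N n : ℂ) * (n * z ^ (n - 1) * a (N + n)) :=
    (((hasDerivAt_pow n z).mul_const _).const_mul _).deriv
  simp_rw [hterm] at hsum
  have hderiv : deriv (iteratedDerivSeries a N) z = iteratedDerivSeries a (N + 1) z := by
    refine hsum.tsum_eq.symm.trans ?_
    rw [hsum.summable.tsum_eq_zero_add, iteratedDerivSeries]
    simp only [Nat.cast_zero, zero_mul, mul_zero, zero_add]
    refine tsum_congr fun n => ?_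
    rw [intertwineCoeff_succ, Nat.add_sub_cancel, show N + 1 + n = N + (n + 1) by ring]
    push_cast
    ring
  exact hderiv ▸ hdiff.hasDerivAt

theorem iteratedDeriv_iteratedDerivSeries_zero {a : ℕ → ℂ} {C : ℝ} (ha : ∀ n, ‖a n‖ ≤ C) (N : ℕ) :
    ∀ z : ℂ, ‖z‖ < 1 → iteratedDeriv N (iteratedDerivSeries a 0) z = iteratedDerivSeries a N z := by
  induction N with
  | zero => simp
  | succ N ih =>
    intro z hz
    have hev : iteratedDeriv N (iteratedDerivSeries a 0) =ᶠ[𝓝 z] iteratedDerivSeries a N := by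
      filter_upwards [Metric.isOpen_ball.mem_nhds (mem_ball_zero_iff.2 hz)] with w hw
      exact ih w (mem_ball_zero_iff.1 hw)
    rw [iteratedDeriv_succ, hev.deriv_eq, (hasDerivAt_iteratedDerivSeries ha N hz).deriv]

theorem iteratedDerivSeries_apply_zero (a : ℕ → ℂ) (N : ℕ) :
    iteratedDerivSeries a N 0 = N.factorial * a N := by
  rw [iteratedDerivSeries, tsum_eq_single 0 fun n hn => by simp [hn]]
  simp [intertwineCoeff_eq_descFactorial, Nat.descFactorial_self]

/-- A power series with bounded coefficients all of whose derivatives vanish at a point of the open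
unit disc is zero. -/
theorem eq_zero_of_iteratedDerivSeries_eq_zero {a : ℕ → ℂ} {C : ℝ} (ha : ∀ n, ‖a n‖ ≤ C)
    {c : ℂ} (hc : ‖c‖ < 1) (h : ∀ N, iteratedDerivSeries a N c = 0) (N : ℕ) : a N = 0 := by
  have hdiff : DifferentiableOn ℂ (iteratedDerivSeries a 0) (Metric.ball 0 1) := fun z hz =>
    (hasDerivAt_iteratedDerivSeries ha 0 (mem_ball_zero_iff.1 hz)).differentiableAt
      |>.differentiableWithinAt
  have hsub : Metric.ball c (1 - ‖c‖) ⊆ Metric.ball 0 1 :=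
    Metric.ball_subset_ball' (by simp)
  have hlocal : iteratedDerivSeries a 0 =ᶠ[𝓝 c] 0 := by
    filter_upwards [Metric.ball_mem_nhds c (sub_pos.2 hc)] with z hz
    rw [← Complex.taylorSeries_eq_on_ball (hdiff.mono hsub) hz]
    simp [iteratedDeriv_iteratedDerivSeries_zero ha _ c hc, h]
  have hzero : Set.EqOn (iteratedDerivSeries a 0) 0 (Metric.ball 0 1) :=
    (hdiff.analyticOnNhd Metric.isOpen_ball).eqOn_zero_of_preconnected_of_eventuallyEq_zero
      (convex_ball 0 1).isPreconnected (mem_ball_zero_iff.2 hc) hlocal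
  have hnear : iteratedDerivSeries a 0 =ᶠ[𝓝 0] fun _ => 0 :=
    hzero.eventuallyEq_of_mem (Metric.ball_mem_nhds 0 one_pos)
  have hN : (N.factorial : ℂ) * a N = 0 := by
    rw [← iteratedDerivSeries_apply_zero, ← iteratedDeriv_iteratedDerivSeries_zero ha N 0 (by simp),
      hnear.iteratedDeriv_eq N]
    simp
  exact (mul_eq_zero.1 hN).resolve_left (Nat.cast_ne_zero.2 N.factorial_ne_zero)

section Isometry

variable {H : Type*} [NormedAddCommGroup H] [InnerProductSpace ℂ H]

theorem norm_pow_apply_of_norm_apply {S : H →L[ℂ] H} (hiso : ∀ x : H, ‖S x‖ = ‖x‖) (n : ℕ)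
    (x : H) : ‖(S ^ n) x‖ = ‖x‖ := by
  induction n with
  | zero => simp
  | succ n ih => rw [pow_succ', mul_apply_eq_comp, hiso, ih]

theorem inner_pow_apply_of_norm_apply {S : H →L[ℂ] H} (hiso : ∀ x : H, ‖S x‖ = ‖x‖) (n : ℕ)
    (x y : H) : inner ℂ ((S ^ n) x) ((S ^ n) y) = inner ℂ x y :=
  (LinearMap.norm_map_iff_inner_map_map (S ^ n)).1 (norm_pow_apply_of_norm_apply hiso n) x y

variable [CompleteSpace H]

theorem mem_range_of_orthogonal_ker_adjoint {S : H →L[ℂ] H} (hiso : ∀ x : H, ‖S x‖ = ‖x‖) {y : H}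
    (hy : ∀ w, ContinuousLinearMap.adjoint S w = 0 → inner ℂ y w = 0) : ∃ z, S z = y := by
  have hS : Isometry S := AddMonoidHomClass.isometry_of_norm S hiso
  have hmem : y ∈ (ContinuousLinearMap.adjoint S).kerᗮ :=
    (Submodule.mem_orthogonal' _ _).2 fun w hw => hy w hw
  rw [ContinuousLinearMap.orthogonal_ker, ContinuousLinearMap.adjoint_adjoint,
    ← SetLike.mem_coe, Submodule.topologicalClosure_coe, LinearMap.coe_range] at hmem
  rwa [IsClosed.closure_eq] at hmem
  exact hS.isClosedEmbedding.isClosed_range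

/-- A vector orthogonal to all `Sⁿ (ker S*)` lies in the range of every power of the isometry
`S`. -/
theorem mem_range_pow_of_orthogonal {S : H →L[ℂ] H} (hiso : ∀ x : H, ‖S x‖ = ‖x‖) {x : H}
    (hx : ∀ w, ContinuousLinearMap.adjoint S w = 0 → ∀ n : ℕ, inner ℂ x ((S ^ n) w) = 0)
    (n : ℕ) : x ∈ Set.range ⇑(S ^ n) := by
  induction n with
  | zero => exact ⟨x, rfl⟩
  | succ n ih =>
    obtain ⟨y, rfl⟩ := ih
    obtain ⟨z, rfl⟩ := mem_range_of_orthogonal_ker_adjoint hiso fun w hw =>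
      (inner_pow_apply_of_norm_apply hiso n y w).symm.trans (hx w hw n)
    exact ⟨z, by rw [pow_succ, mul_apply_eq_comp]⟩

theorem summable_intertwine {S : H →L[ℂ] H} (hiso : ∀ x : H, ‖S x‖ = ‖x‖) {c : ℂ} (hc : ‖c‖ < 1)
    (N : ℕ) (w : H) :
    Summable fun n : ℕ => (intertwineCoeff N n : ℂ) • c ^ n • (S ^ (N + n)) w := by
  refine Summable.of_norm ?_
  refine ((summable_intertwineCoeff_mul_pow N (norm_nonneg c) hc).mul_right ‖w‖).congr fun n => ?_
  rw [norm_smul, norm_smul, norm_pow, Complex.norm_natCast, norm_pow_apply_of_norm_apply hiso,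
    mul_assoc]

theorem inner_tsum_intertwine {S : H →L[ℂ] H} (hiso : ∀ x : H, ‖S x‖ = ‖x‖) {c : ℂ}
    (hc : ‖c‖ < 1) (N : ℕ) (x w : H) :
    inner ℂ x (∑' n : ℕ, (intertwineCoeff N n : ℂ) • c ^ n • (S ^ (N + n)) w)
      = iteratedDerivSeries (fun n => inner ℂ x ((S ^ n) w)) N c := by
  rw [← innerSL_apply_apply, (innerSL ℂ x).map_tsum (summable_intertwine hiso hc N w),
    iteratedDerivSeries]
  simp

end Isometry

theorem stmt_8 (H : Type*) [NormedAddCommGroup H] [InnerProductSpace ℂ H] [CompleteSpace H]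
    (S : H →L[ℂ] H) (hiso : ∀ x : H, ‖S x‖ = ‖x‖)
    (hcnu : (⋂ n : ℕ, Set.range ⇑(S ^ n)) = {0})
    (lam : ℂ) (hlam : ‖lam‖ < 1) :
    (Submodule.span ℂ
        {v : H | ∃ (N : ℕ) (w : H), ContinuousLinearMap.adjoint S w = 0 ∧
          v = ∑' n : ℕ, (intertwineCoeff N n : ℂ) • lam ^ n • (S ^ (N + n)) w}).topologicalClosure
      = ⊤ := by
  rw [Submodule.topologicalClosure_eq_top_iff, Submodule.eq_bot_iff]
  intro x hx
  rw [Submodule.mem_orthogonal'] at hx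
  have horth (w : H) (hw : ContinuousLinearMap.adjoint S w = 0) (n : ℕ) :
      inner ℂ x ((S ^ n) w) = 0 := by
    refine eq_zero_of_iteratedDerivSeries_eq_zero (a := fun n => inner ℂ x ((S ^ n) w))
      (C := ‖x‖ * ‖w‖) (fun k => ?_) hlam (fun N => ?_) n
    · exact (norm_inner_le_norm x _).trans_eq (by rw [norm_pow_apply_of_norm_apply hiso])
    · rw [← inner_tsum_intertwine hiso hlam]
      exact hx _ (Submodule.subset_span ⟨N, w, hw, rfl⟩)
  have hmem : x ∈ ⋂ n : ℕ, Set.range ⇑(S ^ n) :=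
    Set.mem_iInter.2 (mem_range_pow_of_orthogonal hiso horth)
  rwa [hcnu] at hmem
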